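/- Gauss' summation formula: let a, b, c ∈ ℂ with Re(c − a − b) > 0 and c not a nonpositive integer. Then the series ∑_{k=0}^∞ (a)_k (b)_k / ((c)_k · k!) converges absolutely and its sum equals Γ(c) Γ(c − a − b) / (Γ(c − a) Γ(c − b)). -/

import Mathlib

open Complex Filter

/-- Pochhammer symbol `(a)_k = a (a+1) ⋯ (a+k-1)`. -/
noncomputable def poch (a : ℂ) (k : ℕ) : ℂ := ∏ i ∈ Finset.range k, (a + i)

theorem poch_succ (a : ℂ) (k : ℕ) : poch a (k + 1) = poch a k * (a + k) :=
  Finset.prod_range_succ _ _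

theorem poch_succ_left (a : ℂ) (k : ℕ) : poch a (k + 1) = a * poch (a + 1) k := by
  unfold poch
  rw [Finset.prod_range_succ', mul_comm]
  congr 1
  · simp
  · refine Finset.prod_congr rfl fun i _ => ?_
    push_cast
    ring

theorem add_natCast_ne_zero {c : ℂ} (hc : ∀ m : ℕ, c ≠ -(m : ℂ)) (k : ℕ) : c + k ≠ 0 :=
  fun h => hc k (eq_neg_of_add_eq_zero_left h)

theorem add_natCast_ne_neg {c : ℂ} (hc : ∀ m : ℕ, c ≠ -(m : ℂ)) (k m : ℕ) :
    c + k ≠ -(m : ℂ) := by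
  intro h
  apply hc (k + m)
  push_cast
  linear_combination h

theorem ne_neg_natCast_of_re_pos {c : ℂ} (hc : 0 < c.re) (m : ℕ) : c ≠ -(m : ℂ) := by
  rintro rfl
  have : (0 : ℝ) ≤ m := m.cast_nonneg
  simp at hc
  linarith

theorem poch_ne_zero {c : ℂ} (hc : ∀ m : ℕ, c ≠ -(m : ℂ)) (k : ℕ) : poch c k ≠ 0 :=
  Finset.prod_ne_zero_iff.2 fun i _ => add_natCast_ne_zero hc i

theorem poch_succ_eq (a : ℂ) {n : ℕ} (hn : n ≠ 0) :
    poch a (n + 1) = (n : ℂ) ^ a * n.factorial * (GammaSeq a n)⁻¹ := by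
  have h1 : (n : ℂ) ^ a ≠ 0 := by simp [Complex.cpow_eq_zero_iff, hn]
  have h2 : (n.factorial : ℂ) ≠ 0 := by exact_mod_cast n.factorial_ne_zero
  unfold GammaSeq poch
  rw [inv_div]
  field_simp

/-- The reciprocal of Euler's sequence converges to `1 / Γ(s)`, also at the poles of `Γ`. -/
theorem tendsto_inv_GammaSeq (s : ℂ) :
    Tendsto (fun n => (GammaSeq s n)⁻¹) atTop (nhds (Complex.Gamma s)⁻¹) := by
  by_cases h : Complex.Gamma s = 0
  · obtain ⟨m, rfl⟩ := (Complex.Gamma_eq_zero_iff s).1 h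
    rw [h, inv_zero]
    refine tendsto_const_nhds.congr' ?_
    filter_upwards [eventually_ge_atTop m] with n hn
    have : ∏ j ∈ Finset.range (n + 1), (-(m : ℂ) + j) = 0 :=
      Finset.prod_eq_zero (i := m) (Finset.mem_range.2 (by omega)) (by simp)
    simp [GammaSeq, this]
  · exact (GammaSeq_tendsto_Gamma s).inv₀ h

/-- The `k`-th term of the hypergeometric series `₂F₁(a, b; c; 1)`. -/
noncomputable def gaussTerm (a b c : ℂ) (k : ℕ) : ℂ :=
  poch a k * poch b k / (poch c k * (Nat.factorial k : ℂ))

theorem succ_mul_gaussTerm_succ (a b c : ℂ) {n : ℕ} (hn : n ≠ 0) :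
    ((n : ℂ) + 1) * gaussTerm a b c (n + 1) =
      (n : ℂ) ^ (-(c - a - b)) * ((GammaSeq a n)⁻¹ * (GammaSeq b n)⁻¹ * GammaSeq c n) := by
  have hn' : (n : ℂ) ≠ 0 := by exact_mod_cast hn
  have h1 : (n : ℂ) ^ c ≠ 0 := by simp [Complex.cpow_eq_zero_iff, hn]
  have h2 : (n.factorial : ℂ) ≠ 0 := by exact_mod_cast n.factorial_ne_zero
  have h3 : (n : ℂ) + 1 ≠ 0 := by exact_mod_cast n.succ_ne_zero
  have h4 : (n : ℂ) ^ (-(c - a - b)) = (n : ℂ) ^ a * (n : ℂ) ^ b / (n : ℂ) ^ c := by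
    rw [← Complex.cpow_add _ _ hn', ← Complex.cpow_sub _ _ hn']
    congr 1
    ring
  rw [gaussTerm, poch_succ_eq a hn, poch_succ_eq b hn, poch_succ_eq c hn, h4, Nat.factorial_succ]
  generalize (GammaSeq a n)⁻¹ = x
  generalize (GammaSeq b n)⁻¹ = y
  push_cast
  rw [div_eq_mul_inv _ (_ * _ : ℂ), mul_inv, mul_inv, mul_inv, inv_inv]
  field_simp

theorem exists_norm_succ_mul_gaussTerm_le (a b c : ℂ) :
    ∃ C : ℝ, ∀ᶠ n : ℕ in atTop,
      ‖((n : ℂ) + 1) * gaussTerm a b c (n + 1)‖ ≤ C * (n : ℝ) ^ (-(c - a - b).re) := by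
  have h := (((tendsto_inv_GammaSeq a).mul (tendsto_inv_GammaSeq b)).mul
    (GammaSeq_tendsto_Gamma c)).norm
  refine ⟨‖(Complex.Gamma a)⁻¹ * (Complex.Gamma b)⁻¹ * Complex.Gamma c‖ + 1, ?_⟩
  filter_upwards [h.eventually_le_const (lt_add_one _), eventually_gt_atTop 0] with n h1 hn
  rw [succ_mul_gaussTerm_succ a b c hn.ne', norm_mul, Complex.norm_natCast_cpow_of_pos hn, mul_comm,
    Complex.neg_re]
  gcongr

theorem summable_norm_gaussTerm {a b c : ℂ} (hre : 0 < (c - a - b).re) :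
    Summable fun k => ‖gaussTerm a b c k‖ := by
  rw [← summable_nat_add_iff 1]
  obtain ⟨C, hC⟩ := exists_norm_succ_mul_gaussTerm_le a b c
  have hs : Summable fun n : ℕ => C * (n : ℝ) ^ (-(c - a - b).re - 1) :=
    (Real.summable_nat_rpow.2 (by linarith)).mul_left C
  refine summable_of_isBigO_nat hs (Asymptotics.IsBigO.of_bound 1 ?_)
  filter_upwards [hC, eventually_gt_atTop 0] with n h1 hn
  have hn' : (0 : ℝ) < n := by exact_mod_cast hn
  have h2 : ‖(n : ℂ) + 1‖ = (n : ℝ) + 1 := by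
    rw [← Nat.cast_succ, Complex.norm_natCast, Nat.cast_succ]
  rw [norm_mul, h2] at h1
  rw [norm_norm, one_mul, Real.rpow_sub_one hn'.ne', ← mul_div_assoc]
  refine le_trans ?_ (le_abs_self _)
  rw [le_div_iff₀ hn']
  nlinarith [norm_nonneg (gaussTerm a b c (n + 1))]

theorem tendsto_natCast_mul_gaussTerm {a b c : ℂ} (hre : 0 < (c - a - b).re) :
    Tendsto (fun k : ℕ => (k : ℂ) * gaussTerm a b c k) atTop (nhds 0) := by
  rw [← tendsto_add_atTop_iff_nat 1]
  obtain ⟨C, hC⟩ := exists_norm_succ_mul_gaussTerm_le a b c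
  push_cast
  refine squeeze_zero_norm' hC ?_
  simpa using ((tendsto_rpow_neg_atTop hre).comp tendsto_natCast_atTop_atTop).const_mul C

theorem gaussTerm_contiguous (a b : ℂ) {c : ℂ} (hc : ∀ m : ℕ, c ≠ -(m : ℂ)) (k : ℕ) :
    c * (c - a - b) * gaussTerm a b c k - (c - a) * (c - b) * gaussTerm a b (c + 1) k =
      c * ((k : ℂ) * gaussTerm a b c k)
        - c * (((k + 1 : ℕ) : ℂ) * gaussTerm a b c (k + 1)) := by
  have h0 : c ≠ 0 := by simpa using hc 0
  have h1 := add_natCast_ne_zero hc k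
  have h2 := poch_ne_zero hc k
  have h3 : (k.factorial : ℂ) ≠ 0 := by exact_mod_cast k.factorial_ne_zero
  have h4 : (k : ℂ) + 1 ≠ 0 := by exact_mod_cast k.succ_ne_zero
  have h5 : poch (c + 1) k = poch c k * (c + k) / c := by
    rw [eq_div_iff h0, ← poch_succ, poch_succ_left, mul_comm]
  simp only [gaussTerm, h5, poch_succ, Nat.factorial_succ]
  push_cast
  field_simp
  ring

theorem tsum_gaussTerm_contiguous {a b c : ℂ} (hre : 0 < (c - a - b).re)
    (hc : ∀ m : ℕ, c ≠ -(m : ℂ)) :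
    c * (c - a - b) * ∑' k, gaussTerm a b c k =
      (c - a) * (c - b) * ∑' k, gaussTerm a b (c + 1) k := by
  have hre' : 0 < (c + 1 - a - b).re := by simp at hre ⊢; linarith
  have h1 := ((summable_norm_gaussTerm hre).of_norm.hasSum.mul_left (c * (c - a - b))).sub
    ((summable_norm_gaussTerm hre').of_norm.hasSum.mul_left ((c - a) * (c - b)))
  have h2 := h1.tendsto_sum_nat
  simp only [gaussTerm_contiguous a b hc] at h2
  have h3 : Tendsto (fun n : ℕ => -(c * ((n : ℂ) * gaussTerm a b c n))) atTop (nhds 0) := by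
    simpa using ((tendsto_natCast_mul_gaussTerm hre).const_mul c).neg
  refine sub_eq_zero.1 (tendsto_nhds_unique h2 (h3.congr fun n => ?_))
  rw [Finset.sum_range_sub' fun k : ℕ => c * ((k : ℂ) * gaussTerm a b c k)]
  simp

theorem poch_mul_tsum_gaussTerm {a b c : ℂ} (hre : 0 < (c - a - b).re)
    (hc : ∀ m : ℕ, c ≠ -(m : ℂ)) (m : ℕ) :
    poch c m * poch (c - a - b) m * ∑' k, gaussTerm a b c k =
      poch (c - a) m * poch (c - b) m * ∑' k, gaussTerm a b (c + m) k := by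
  induction m with
  | zero => simp [poch]
  | succ m ih =>
    have hre' : 0 < (c + m - a - b).re := by
      have : (0 : ℝ) ≤ m := m.cast_nonneg
      simp at hre ⊢
      linarith
    have h := tsum_gaussTerm_contiguous hre' (add_natCast_ne_neg hc m)
    simp only [poch_succ]
    rw [Nat.cast_succ, ← add_assoc]
    linear_combination (c + m) * (c - a - b + m) * ih + poch (c - a) m * poch (c - b) m * h

theorem norm_poch_le (a : ℂ) (k : ℕ) : ‖poch a k‖ ≤ ‖poch (‖a‖ : ℂ) k‖ := by
  simp only [poch, norm_prod]
  refine Finset.prod_le_prod (fun _ _ => norm_nonneg _) fun i _ => (norm_add_le _ _).trans ?_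
  rw [← Complex.ofReal_natCast, ← Complex.ofReal_add, Complex.norm_real, Complex.norm_real,
    Real.norm_of_nonneg i.cast_nonneg, Real.norm_of_nonneg (by positivity)]

theorem norm_poch_ofReal_le {r : ℝ} {c : ℂ} (hr : 0 ≤ r) (hrc : r ≤ c.re) (k : ℕ) :
    ‖poch (r : ℂ) k‖ ≤ ‖poch c k‖ := by
  simp only [poch, norm_prod]
  refine Finset.prod_le_prod (fun _ _ => norm_nonneg _) fun i _ => ?_
  rw [← Complex.ofReal_natCast, ← Complex.ofReal_add, Complex.norm_real,
    Real.norm_of_nonneg (by positivity)]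
  refine le_trans ?_ (Complex.re_le_norm _)
  simpa using hrc

theorem norm_gaussTerm_le (a b : ℂ) {r : ℝ} {c : ℂ} (hr : 0 < r) (hrc : r ≤ c.re) (k : ℕ) :
    ‖gaussTerm a b c k‖ ≤ ‖gaussTerm (‖a‖ : ℂ) (‖b‖ : ℂ) (r : ℂ) k‖ := by
  have h1 : 0 < ‖poch (r : ℂ) k‖ :=
    norm_pos_iff.2 (poch_ne_zero (ne_neg_natCast_of_re_pos (by simpa using hr)) k)
  have h2 : 0 < ‖(k.factorial : ℂ)‖ :=
    norm_pos_iff.2 (by exact_mod_cast k.factorial_ne_zero)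
  simp only [gaussTerm, norm_div, norm_mul]
  gcongr
  · exact norm_poch_le a k
  · exact norm_poch_le b k
  · exact norm_poch_ofReal_le hr.le hrc k

theorem tendsto_norm_poch_add_natCast (c : ℂ) (k : ℕ) :
    Tendsto (fun m : ℕ => ‖poch (c + m) (k + 1)‖) atTop atTop := by
  have hre : Tendsto (fun m : ℕ => c.re + m) atTop atTop :=
    tendsto_atTop_add_const_left _ _ tendsto_natCast_atTop_atTop
  refine tendsto_atTop_mono' _ ?_ hre
  filter_upwards [hre.eventually_ge_atTop 1] with m hm
  have h (i : ℕ) : c.re + m ≤ ‖c + m + i‖ := by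
    refine le_trans ?_ (Complex.re_le_norm _)
    simp
  rw [poch, norm_prod, Finset.prod_range_succ]
  have h1 : 1 ≤ ∏ i ∈ Finset.range k, ‖c + m + (i : ℂ)‖ :=
    Finset.one_le_prod fun i _ => hm.trans (h i)
  nlinarith [h k]

theorem tendsto_gaussTerm_add_natCast (a b c : ℂ) (k : ℕ) :
    Tendsto (fun m : ℕ => gaussTerm a b (c + m) k) atTop (nhds (if k = 0 then 1 else 0)) := by
  cases k with
  | zero => simp [gaussTerm, poch]
  | succ k =>
    have h : Tendsto (fun m : ℕ => (poch (c + m) (k + 1))⁻¹) atTop (nhds 0) :=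
      tendsto_inv₀_cobounded.comp
        (tendsto_norm_atTop_iff_cobounded.1 (tendsto_norm_poch_add_natCast c k))
    have h' := h.const_mul (poch a (k + 1) * poch b (k + 1) / ((k + 1).factorial : ℂ))
    rw [mul_zero] at h'
    rw [if_neg k.succ_ne_zero]
    refine h'.congr fun m => ?_
    rw [gaussTerm, div_eq_mul_inv, div_eq_mul_inv, mul_inv]
    ring

theorem tendsto_tsum_gaussTerm_add_natCast (a b c : ℂ) :
    Tendsto (fun m : ℕ => ∑' k, gaussTerm a b (c + m) k) atTop (nhds 1) := by
  have hre : Tendsto (fun m : ℕ => c.re + m) atTop atTop :=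
    tendsto_atTop_add_const_left _ _ tendsto_natCast_atTop_atTop
  have hs : Summable fun k => ‖gaussTerm (‖a‖ : ℂ) (‖b‖ : ℂ) ((‖a‖ + ‖b‖ + 1 : ℝ) : ℂ) k‖ := by
    apply summable_norm_gaussTerm
    simp only [Complex.sub_re, Complex.ofReal_re]
    linarith
  have h := tendsto_tsum_of_dominated_convergence (𝓕 := atTop) hs
    (tendsto_gaussTerm_add_natCast a b c) <| by
      filter_upwards [hre.eventually_ge_atTop (‖a‖ + ‖b‖ + 1)] with m hm k
      exact norm_gaussTerm_le a b (by positivity) (by simpa using hm) k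
  simpa using h

/-- Gauss' summation formula. -/
theorem gauss_summation (a b c : ℂ) (hre : 0 < (c - a - b).re)
    (hc : ∀ m : ℕ, c ≠ -(m : ℂ)) :
    Summable (fun k : ℕ =>
      ‖poch a k * poch b k / (poch c k * (Nat.factorial k : ℂ))‖) ∧
    ∑' k : ℕ, poch a k * poch b k / (poch c k * (Nat.factorial k : ℂ)) =
      Complex.Gamma c * Complex.Gamma (c - a - b) /
        (Complex.Gamma (c - a) * Complex.Gamma (c - b)) := by
  refine ⟨summable_norm_gaussTerm hre, ?_⟩
  change ∑' k, gaussTerm a b c k = _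
  have hd := ne_neg_natCast_of_re_pos hre
  have h1 := (((GammaSeq_tendsto_Gamma c).mul (GammaSeq_tendsto_Gamma (c - a - b))).mul
    ((tendsto_inv_GammaSeq (c - a)).mul (tendsto_inv_GammaSeq (c - b)))).mul
    ((tendsto_tsum_gaussTerm_add_natCast a b c).comp (tendsto_add_atTop_nat 1))
  rw [mul_one, ← mul_inv, ← div_eq_mul_inv] at h1
  refine tendsto_nhds_unique (tendsto_const_nhds.congr' ?_) h1
  filter_upwards [eventually_ne_atTop 0] with n hn
  have hn' : (n : ℂ) ≠ 0 := by exact_mod_cast hn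
  have h2 := poch_mul_tsum_gaussTerm hre hc (n + 1)
  have h3 := poch_ne_zero hc (n + 1)
  have h4 := poch_ne_zero hd (n + 1)
  have h5 : (n : ℂ) ^ (c - a) * (n : ℂ) ^ (c - b) = (n : ℂ) ^ c * (n : ℂ) ^ (c - a - b) := by
    rw [← Complex.cpow_add _ _ hn', ← Complex.cpow_add _ _ hn']
    congr 1
    ring
  have h6 : (n : ℂ) ^ c * (n : ℂ) ^ (c - a - b) ≠ 0 := by
    simp [Complex.cpow_eq_zero_iff, hn]
  have h7 : (n.factorial : ℂ) ≠ 0 := by exact_mod_cast n.factorial_ne_zero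
  rw [poch_succ_eq _ hn] at h3 h4
  have h8 : GammaSeq c n ≠ 0 := by simpa using right_ne_zero_of_mul h3
  have h9 : GammaSeq (c - a - b) n ≠ 0 := by simpa using right_ne_zero_of_mul h4
  simp only [poch_succ_eq _ hn] at h2
  simp only [Function.comp_apply]
  generalize (GammaSeq (c - a) n)⁻¹ = x at h2 ⊢
  generalize (GammaSeq (c - b) n)⁻¹ = y at h2 ⊢
  generalize ∑' k, gaussTerm a b (c + (n + 1 : ℕ)) k = S at h2 ⊢
  generalize ∑' k, gaussTerm a b c k = T at h2 ⊢
  have h10 : ((n : ℂ) ^ c * (n : ℂ) ^ (c - a - b) * (n.factorial : ℂ) ^ 2) *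
      ((GammaSeq c n)⁻¹ * (GammaSeq (c - a - b) n)⁻¹ * T) =
      ((n : ℂ) ^ c * (n : ℂ) ^ (c - a - b) * (n.factorial : ℂ) ^ 2) * (x * y * S) := by
    linear_combination h2 + (n.factorial : ℂ) ^ 2 * x * y * S * h5
  have h11 := mul_left_cancel₀ (mul_ne_zero h6 (pow_ne_zero 2 h7)) h10
  field_simp at h11
  linear_combination h11
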